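/- Let G be a connected non-bipartite simple graph with m ≥ 240² edges whose spectral radius ρ = ρ(G) satisfies ρ² ≥ m − 1 + 2/(ρ − 1). Then the booksize satisfies bk(G) > (1/240)√m, unless G is isomorphic to S⁺_{m,s} for some positive integer s ≤ (1/240)√m with s dividing m − 1. -/

import Mathlib

open Classical in
/-- The (classical) real adjacency matrix of a simple graph. -/
noncomputable def adjMat {V : Type*} (G : SimpleGraph V) : Matrix V V ℝ :=
  Matrix.of fun i j => if G.Adj i j then (1 : ℝ) else 0

theorem adjMat_isHermitian {V : Type*} (G : SimpleGraph V) :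
    (adjMat G).IsHermitian := by
  classical
  unfold Matrix.IsHermitian
  ext i j
  simp only [Matrix.conjTranspose_apply, adjMat, Matrix.of_apply, star_trivial]
  by_cases h : G.Adj i j
  · simp [h, h.symm]
  · have h' : ¬ G.Adj j i := fun hh => h hh.symm
    simp [h, h']

/-- The spectral radius of a finite simple graph: the largest eigenvalue of its
adjacency matrix. -/
noncomputable def specRad {V : Type*} [Fintype V] [DecidableEq V] (G : SimpleGraph V) : ℝ :=
  ⨆ i, (adjMat_isHermitian G).eigenvalues i

/-- `SPlus s t` is the graph obtained from the complete bipartite graph `K_{s,t}`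
(on parts `Fin s` and `Fin t`) by adding one edge inside the part of size `t`
(joining the vertices with values `0` and `1`).  For `s ∣ m - 1` and
`t = (m-1)/s ≥ 2` this is the graph `S⁺_{m,s}`, with exactly `m` edges. -/
def SPlus (s t : ℕ) : SimpleGraph (Fin s ⊕ Fin t) :=
  SimpleGraph.fromRel (fun a b =>
    (a.isLeft ∧ b.isRight) ∨
      (∃ i j : Fin t, a = Sum.inr i ∧ b = Sum.inr j ∧ (i : ℕ) = 0 ∧ (j : ℕ) = 1))

section PerronVector

open scoped Matrix

variable {V : Type*} {G : SimpleGraph V}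

theorem adjMat_of_adj {u v : V} (h : G.Adj u v) : adjMat G u v = 1 := by
  simp [adjMat, h]

theorem adjMat_of_not_adj {u v : V} (h : ¬ G.Adj u v) : adjMat G u v = 0 := by
  simp [adjMat, h]

theorem adjMat_nonneg (u v : V) : 0 ≤ adjMat G u v := by
  by_cases h : G.Adj u v <;> simp [adjMat, h]

theorem adjMat_le_one (u v : V) : adjMat G u v ≤ 1 := by
  by_cases h : G.Adj u v <;> simp [adjMat, h]

theorem adjMat_symm (u v : V) : adjMat G u v = adjMat G v u := by
  by_cases h : G.Adj u v <;> simp [adjMat, h, G.adj_comm v u]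

variable [Fintype V]

theorem sum_adjMat (G : SimpleGraph V) :
    ∑ u, ∑ v, adjMat G u v = 2 * (G.edgeSet.ncard : ℝ) := by
  classical
  have h := G.sum_degrees_eq_twice_card_edges
  rw [Set.ncard_eq_toFinset_card', ← SimpleGraph.edgeFinset]
  have h' : (∑ v, (G.degree v : ℝ)) = 2 * (G.edgeFinset.card : ℝ) := by exact_mod_cast h
  rw [← h']
  refine Finset.sum_congr rfl fun u _ => ?_
  simp [adjMat, ← SimpleGraph.card_neighborFinset_eq_degree, SimpleGraph.neighborFinset_eq_filter]

theorem sum_adjMat_mul_adjMat (G : SimpleGraph V) (u v : V) :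
    ∑ w, adjMat G u w * adjMat G v w =
      ((G.neighborSet u ∩ G.neighborSet v).ncard : ℝ) := by
  classical
  rw [Set.ncard_eq_toFinset_card']
  have h1 : ∀ w, adjMat G u w * adjMat G v w = if G.Adj u w ∧ G.Adj v w then 1 else 0 := by
    intro w
    by_cases h : G.Adj u w <;> by_cases h' : G.Adj v w <;> simp [adjMat, h, h']
  simp only [h1, Finset.sum_boole]
  congr 2
  ext w
  simp

/-- A Perron vector of `G` for the eigenvalue `ρ`, scaled to have maximal entry `1` at `o`. -/
structure IsPerronVector (G : SimpleGraph V) (ρ : ℝ) (x : V → ℝ) (o : V) : Prop where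
  pos : ∀ v, 0 < x v
  le_one : ∀ v, x v ≤ 1
  eq_one : x o = 1
  eig : ∀ u, ∑ v, adjMat G u v * x v = ρ * x u

theorem IsPerronVector.one_lt {ρ : ℝ} {x : V → ℝ} {o : V} (h : IsPerronVector G ρ x o)
    (hconn : G.Connected) (hm : 2 ≤ G.edgeSet.ncard) : 1 < ρ := by
  by_contra! hρ
  have hcard := hconn.card_vert_le_card_edgeSet_add_one
  rw [Nat.card_eq_fintype_card, Nat.card_coe_set_eq] at hcard
  have hsum := sum_adjMat G
  have hnt : Nontrivial V := by
    by_contra hV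
    rw [not_nontrivial_iff_subsingleton] at hV
    have h0 : ∀ u v, adjMat G u v = 0 := fun u v =>
      adjMat_of_not_adj (by rw [Subsingleton.elim u v]; exact G.irrefl)
    simp only [h0, Finset.sum_const_zero] at hsum
    have : (2 : ℝ) ≤ G.edgeSet.ncard := by exact_mod_cast hm
    linarith
  have hdeg : ∀ v, 1 ≤ ∑ u, adjMat G u v := by
    intro v
    obtain ⟨w, hw⟩ := hconn.preconnected.exists_adj_of_nontrivial v
    rw [← adjMat_of_adj hw.symm]
    exact Finset.single_le_sum (f := fun u => adjMat G u v) (fun u _ => adjMat_nonneg u v)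
      (Finset.mem_univ w)
  have h1 : ∑ v, (∑ u, adjMat G u v) * x v = ρ * ∑ v, x v := by
    simp only [Finset.sum_mul, Finset.mul_sum]
    rw [Finset.sum_comm]
    exact Finset.sum_congr rfl fun u _ => h.eig u
  have h2 : ∑ v, (∑ u, adjMat G u v - 1) * x v = 0 := by
    refine le_antisymm ?_ (Finset.sum_nonneg fun v _ =>
      mul_nonneg (sub_nonneg.2 (hdeg v)) (h.pos v).le)
    have : 0 ≤ ∑ v, x v := Finset.sum_nonneg fun v _ => (h.pos v).le
    simp only [sub_mul, one_mul, Finset.sum_sub_distrib, h1]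
    nlinarith
  rw [Finset.sum_eq_zero_iff_of_nonneg fun v _ =>
    mul_nonneg (sub_nonneg.2 (hdeg v)) (h.pos v).le] at h2
  have h3 : ∀ v, ∑ u, adjMat G u v = 1 := by
    intro v
    have := (mul_eq_zero.1 (h2 v (Finset.mem_univ v))).resolve_right (h.pos v).ne'
    linarith
  replace hsum := Finset.sum_comm.trans hsum
  simp only [h3, Finset.sum_const, Finset.card_univ, nsmul_eq_mul, mul_one] at hsum
  have : Fintype.card V = 2 * G.edgeSet.ncard := by exact_mod_cast hsum
  omega

variable [DecidableEq V]

theorem posSemidef_specRad_sub_adjMat (G : SimpleGraph V) :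
    (specRad G • (1 : Matrix V V ℝ) - adjMat G).PosSemidef := by
  have hA := adjMat_isHermitian G
  rw [Matrix.posSemidef_iff_isHermitian_and_spectrum_nonneg]
  constructor
  · refine Matrix.IsHermitian.sub ?_ hA
    simp [Matrix.IsHermitian]
  · intro μ hμ
    rw [← Algebra.algebraMap_eq_smul_one, ← spectrum.singleton_sub_eq,
      hA.spectrum_real_eq_range_eigenvalues] at hμ
    obtain ⟨r, hr, ν, ⟨i, rfl⟩, rfl⟩ := Set.mem_sub.1 hμ
    rw [Set.mem_singleton_iff.1 hr]
    have : hA.eigenvalues i ≤ specRad G :=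
      le_ciSup (f := hA.eigenvalues) (Set.finite_range _).bddAbove i
    simpa using this

theorem exists_isPerronVector (hconn : G.Connected) :
    ∃ x o, IsPerronVector G (specRad G) x o := by
  have hA := adjMat_isHermitian G
  have : Nonempty V := hconn.nonempty
  obtain ⟨i, hi⟩ := exists_eq_ciSup_of_finite (f := hA.eigenvalues)
  replace hi : hA.eigenvalues i = specRad G := hi
  set ρ := specRad G
  set y : V → ℝ := ⇑(hA.eigenvectorBasis i) with hy
  have hAy : adjMat G *ᵥ y = ρ • y := by rw [← hi]; exact hA.mulVec_eigenvectorBasis i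
  have hy0 : y ≠ 0 := by
    intro h
    apply hA.eigenvectorBasis.orthonormal.ne_zero i
    ext v
    exact congrFun h v
  have hpsd := posSemidef_specRad_sub_adjMat G
  set z : V → ℝ := fun v => |y v| with hz
  have hexp : ∀ w : V → ℝ, star w ⬝ᵥ ((ρ • (1 : Matrix V V ℝ) - adjMat G) *ᵥ w) =
      ρ * ∑ u, w u * w u - ∑ u, ∑ v, adjMat G u v * (w u * w v) := by
    intro w
    simp only [Matrix.sub_mulVec, Matrix.smul_mulVec, Matrix.one_mulVec, dotProduct_sub]
    congr 1
    · simp [dotProduct, Finset.mul_sum]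
      exact Finset.sum_congr rfl fun _ _ => by ring
    · simp only [dotProduct, Matrix.mulVec, star_trivial, Finset.mul_sum]
      exact Finset.sum_congr rfl fun _ _ => Finset.sum_congr rfl fun _ _ => by ring
  have hz0 : (ρ • (1 : Matrix V V ℝ) - adjMat G) *ᵥ z = 0 := by
    rw [← hpsd.dotProduct_mulVec_zero_iff]
    refine le_antisymm ?_ (hpsd.dotProduct_mulVec_nonneg z)
    have h0 : star y ⬝ᵥ ((ρ • (1 : Matrix V V ℝ) - adjMat G) *ᵥ y) = 0 := by
      rw [Matrix.sub_mulVec, Matrix.smul_mulVec, Matrix.one_mulVec, hAy, sub_self,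
        dotProduct_zero]
    rw [hexp] at h0 ⊢
    have h1 : ∑ u, z u * z u = ∑ u, y u * y u :=
      Finset.sum_congr rfl fun u _ => abs_mul_abs_self _
    have h2 : ∑ u, ∑ v, adjMat G u v * (y u * y v) ≤ ∑ u, ∑ v, adjMat G u v * (z u * z v) := by
      refine Finset.sum_le_sum fun u _ => Finset.sum_le_sum fun v _ => ?_
      refine mul_le_mul_of_nonneg_left ?_ (adjMat_nonneg u v)
      rw [hz, ← abs_mul]
      exact le_abs_self _
    rw [h1]
    linarith
  have hzeig : ∀ u, ∑ v, adjMat G u v * z v = ρ * z u := by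
    intro u
    have := congrFun hz0 u
    simp only [Matrix.sub_mulVec, Matrix.smul_mulVec, Matrix.one_mulVec, Pi.sub_apply,
      Pi.smul_apply, smul_eq_mul, Pi.zero_apply] at this
    have h2 : (adjMat G *ᵥ z) u = ∑ v, adjMat G u v * z v := rfl
    linarith
  have hznn : ∀ v, 0 ≤ z v := fun v => abs_nonneg _
  have hstep : ∀ u v, G.Adj u v → z u = 0 → z v = 0 := by
    intro u v huv hu
    have h1 := hzeig u
    rw [hu, mul_zero, Finset.sum_eq_zero_iff_of_nonneg
      (fun w _ => mul_nonneg (adjMat_nonneg u w) (hznn w))] at h1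
    simpa [adjMat_of_adj huv] using h1 v (Finset.mem_univ v)
  have hzpos : ∀ v, 0 < z v := by
    intro v
    refine (hznn v).lt_of_ne fun h => hy0 ?_
    funext w
    obtain ⟨p⟩ := hconn.preconnected v w
    have : z w = 0 := by
      have h' : z v = 0 := h.symm
      clear h
      induction p with
      | nil => exact h'
      | cons hadj _ ih => exact ih (hstep _ _ hadj h')
    simpa [hz] using this
  obtain ⟨o, ho⟩ := Finite.exists_max z
  refine ⟨fun v => z v / z o, o, fun v => div_pos (hzpos v) (hzpos o),
    fun v => (div_le_one (hzpos o)).2 (ho v), div_self (hzpos o).ne', fun u => ?_⟩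
  simp only [← mul_div_assoc, ← Finset.sum_div]
  rw [hzeig u]

end PerronVector

section LocalStructure

variable {V : Type*} {G : SimpleGraph V}

/-- The number of neighbors of `v` in `T`. -/
noncomputable def degIn (G : SimpleGraph V) (T : Finset V) (v : V) : ℝ :=
  ∑ z ∈ T, adjMat G v z

theorem degIn_nonneg (T : Finset V) (v : V) : 0 ≤ degIn G T v :=
  Finset.sum_nonneg fun z _ => adjMat_nonneg v z

theorem one_le_degIn {T : Finset V} {u v : V} (huv : G.Adj u v) (hv : v ∈ T) :
    1 ≤ degIn G T u := by
  rw [← adjMat_of_adj huv]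
  exact Finset.single_le_sum (f := fun z => adjMat G u z) (fun z _ => adjMat_nonneg u z) hv

theorem sum_degIn_comm (S T : Finset V) (f g : V → ℝ) :
    ∑ v ∈ S, f v * ∑ z ∈ T, adjMat G v z * g z = ∑ z ∈ T, g z * ∑ v ∈ S, adjMat G z v * f v := by
  simp only [Finset.mul_sum]
  rw [Finset.sum_comm]
  refine Finset.sum_congr rfl fun z _ => Finset.sum_congr rfl fun v _ => ?_
  rw [adjMat_symm v z]
  ring

theorem sum_degIn_mul_half_sub (T : Finset V) (g : V → ℝ) :
    ∑ z ∈ T, degIn G T z * (1 / 2 - g z) =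
      1 / 2 * ∑ z ∈ T, ∑ y ∈ T, adjMat G z y * (1 - g z - g y) := by
  have h := sum_degIn_comm (G := G) T T (fun _ => 1) g
  simp only [mul_one, one_mul] at h
  have h1 : ∑ z ∈ T, degIn G T z * (1 / 2 - g z) =
      1 / 2 * ∑ z ∈ T, ∑ y ∈ T, adjMat G z y - ∑ z ∈ T, g z * ∑ y ∈ T, adjMat G z y := by
    rw [Finset.mul_sum, ← Finset.sum_sub_distrib]
    exact Finset.sum_congr rfl fun z _ => by rw [degIn]; ring
  have h2 : ∑ z ∈ T, ∑ y ∈ T, adjMat G z y * (1 - g z - g y) =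
      ∑ z ∈ T, ∑ y ∈ T, adjMat G z y - ∑ z ∈ T, g z * ∑ y ∈ T, adjMat G z y
        - ∑ z ∈ T, ∑ y ∈ T, adjMat G z y * g y := by
    rw [← Finset.sum_sub_distrib, ← Finset.sum_sub_distrib]
    refine Finset.sum_congr rfl fun z _ => ?_
    rw [Finset.mul_sum, ← Finset.sum_sub_distrib, ← Finset.sum_sub_distrib]
    exact Finset.sum_congr rfl fun y _ => by ring
  rw [h1, h2, h]
  ring

theorem sum_degIn_mul_half_sub_nonneg {T : Finset V} {g : V → ℝ}
    (hg : ∀ z ∈ T, ∀ y ∈ T, G.Adj z y → g z + g y ≤ 1) :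
    0 ≤ ∑ z ∈ T, degIn G T z * (1 / 2 - g z) := by
  rw [sum_degIn_mul_half_sub]
  refine mul_nonneg (by norm_num) (Finset.sum_nonneg fun z hz => Finset.sum_nonneg fun y hy => ?_)
  by_cases h : G.Adj z y
  · exact mul_nonneg (adjMat_nonneg z y) (by linarith [hg z hz y hy h])
  · simp [adjMat_of_not_adj h]

theorem le_sum_degIn_mul_half_sub {T : Finset V} {g : V → ℝ}
    (hg : ∀ z ∈ T, ∀ y ∈ T, G.Adj z y → g z + g y ≤ 1) {p q : V} (hp : p ∈ T) (hq : q ∈ T)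
    (hpq : G.Adj p q) :
    1 - g p - g q ≤ ∑ z ∈ T, degIn G T z * (1 / 2 - g z) := by
  classical
  rw [sum_degIn_mul_half_sub, ← Finset.sum_product']
  have hsub : ({(p, q), (q, p)} : Finset (V × V)) ⊆ T ×ˢ T := by
    intro z hz
    simp only [Finset.mem_insert, Finset.mem_singleton] at hz
    rcases hz with rfl | rfl <;> simp [hp, hq]
  have h := Finset.sum_le_sum_of_subset_of_nonneg
    (f := fun z : V × V => adjMat G z.1 z.2 * (1 - g z.1 - g z.2)) hsub (by
      rintro ⟨z, y⟩ hzy -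
      rw [Finset.mem_product] at hzy
      by_cases h : G.Adj z y
      · exact mul_nonneg (adjMat_nonneg z y) (by linarith [hg z hzy.1 y hzy.2 h])
      · simp [adjMat_of_not_adj h])
  rw [Finset.sum_pair (by simp [hpq.ne])] at h
  simp only [adjMat_of_adj hpq, adjMat_of_adj hpq.symm] at h
  linarith

variable [Fintype V]

open Classical in
/-- The neighbors of `o`. -/
noncomputable def near (G : SimpleGraph V) (o : V) : Finset V :=
  Finset.univ.filter fun v => G.Adj o v

open Classical in
/-- The vertices not adjacent to `o`, including `o` itself. -/
noncomputable def far (G : SimpleGraph V) (o : V) : Finset V :=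
  Finset.univ.filter fun v => ¬ G.Adj o v

/-- The total `x`-weight of the vertices not adjacent to `o`. -/
noncomputable def farMass (G : SimpleGraph V) (x : V → ℝ) (o : V) : ℝ :=
  ∑ v ∈ far G o, x v

/-- The `x`-weight of the vertices adjacent neither to `o` nor to `z`. -/
noncomputable def farMiss (G : SimpleGraph V) (x : V → ℝ) (o z : V) : ℝ :=
  ∑ v ∈ far G o, (1 - adjMat G z v) * x v

theorem mem_near {o v : V} : v ∈ near G o ↔ G.Adj o v := by simp [near]

theorem mem_far {o v : V} : v ∈ far G o ↔ ¬ G.Adj o v := by simp [far]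

theorem self_mem_far (G : SimpleGraph V) (o : V) : o ∈ far G o := mem_far.2 G.irrefl

theorem sum_near_add_sum_far (G : SimpleGraph V) (o : V) (f : V → ℝ) :
    ∑ v ∈ near G o, f v + ∑ v ∈ far G o, f v = ∑ v, f v := by
  classical exact Finset.sum_filter_add_sum_filter_not _ _ _

theorem sum_adjMat_mul (G : SimpleGraph V) (o : V) (f : V → ℝ) :
    ∑ v, adjMat G o v * f v = ∑ v ∈ near G o, f v := by
  classical
  rw [near, Finset.sum_filter]
  exact Finset.sum_congr rfl fun v _ => by by_cases h : G.Adj o v <;> simp [adjMat, h]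

theorem farMiss_nonneg {x : V → ℝ} (hx : ∀ v, 0 < x v) (o z : V) : 0 ≤ farMiss G x o z :=
  Finset.sum_nonneg fun v _ => mul_nonneg (sub_nonneg.2 (adjMat_le_one z v)) (hx v).le

theorem farMass_sub_farMiss (x : V → ℝ) (o z : V) :
    farMass G x o - farMiss G x o z = ∑ v ∈ far G o, adjMat G z v * x v := by
  rw [farMass, farMiss, ← Finset.sum_sub_distrib]
  exact Finset.sum_congr rfl fun v _ => by ring

theorem degIn_near_le {b : ℝ}
    (hb : ∀ u v, G.Adj u v → ∑ w, adjMat G u w * adjMat G v w ≤ b) {o z : V}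
    (hz : z ∈ near G o) : degIn G (near G o) z ≤ b := by
  rw [degIn, ← sum_adjMat_mul]
  exact hb o z (mem_near.1 hz)

theorem two_mul_ncard_edgeSet (G : SimpleGraph V) (o : V) :
    2 * (G.edgeSet.ncard : ℝ) = ∑ z ∈ near G o, degIn G (near G o) z
      + 2 * ∑ v ∈ far G o, degIn G (near G o) v + ∑ v ∈ far G o, degIn G (far G o) v := by
  have hsplit : ∀ u, ∑ v, adjMat G u v = degIn G (near G o) u + degIn G (far G o) u := fun u =>
    (sum_near_add_sum_far G o _).symm
  have hNS : ∑ u ∈ near G o, degIn G (far G o) u = ∑ v ∈ far G o, degIn G (near G o) v := by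
    have := sum_degIn_comm (G := G) (near G o) (far G o) (fun _ => 1) (fun _ => 1)
    simpa [degIn] using this
  rw [← sum_adjMat, ← sum_near_add_sum_far G o]
  simp only [hsplit, Finset.sum_add_distrib]
  linarith

theorem mul_le_sub_add_mul_sub {X Q t : ℝ} (hQ : X / 10 ≤ Q) (hP : 1 ≤ X - Q) (ht0 : 0 < t) (ht1 : t ≤ 1)
    (htX : 238 * t ≤ X) : 239 * (X * t) ≤ (X - Q + t) * (238 * Q - X) := by
  have hX : 0 < X := by linarith
  rcases le_total (0.96 * X) Q with hc | hc
  · have h1 : (1 + t) * (227 * X) ≤ (X - Q + t) * (238 * Q - X) := by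
      apply mul_le_mul <;> linarith
    nlinarith
  · have h1 : 0 ≤ (Q - X / 10) * (0.96 * X - Q) := mul_nonneg (by linarith) (by linarith)
    have h2 : 0 ≤ t * (238 * Q - X) := mul_nonneg ht0.le (by linarith)
    nlinarith

namespace IsPerronVector

variable {ρ b : ℝ} {x : V → ℝ} {o : V}

theorem sum_near (h : IsPerronVector G ρ x o) : ∑ z ∈ near G o, x z = ρ := by
  rw [← sum_adjMat_mul, h.eig, h.eq_one, mul_one]

theorem mul_eq (h : IsPerronVector G ρ x o) (u : V) :
    ρ * x u = ∑ z ∈ near G o, adjMat G u z * x z + ∑ v ∈ far G o, adjMat G u v * x v := by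
  rw [sum_near_add_sum_far, h.eig]

theorem mul_one_sub (h : IsPerronVector G ρ x o) (u : V) :
    ρ * (1 - x u) = ∑ z ∈ near G o, (1 - adjMat G u z) * x z
      - ∑ v ∈ far G o, adjMat G u v * x v := by
  have h1 : ∑ z ∈ near G o, (1 - adjMat G u z) * x z =
      ρ - ∑ z ∈ near G o, adjMat G u z * x z := by
    rw [← h.sum_near, ← Finset.sum_sub_distrib]
    exact Finset.sum_congr rfl fun v _ => by ring
  linarith [h.mul_eq u]

/-- Comparison of the number of edges with `ρ²`, obtained by counting walks of length two
from `o`. -/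
theorem deficit (h : IsPerronVector G ρ x o) :
    ∑ z ∈ near G o, degIn G (near G o) z * (1 / 2 - x z)
      + ∑ v ∈ far G o, degIn G (near G o) v * (1 - x v)
      + 1 / 2 * ∑ v ∈ far G o, degIn G (far G o) v = G.edgeSet.ncard - ρ ^ 2 := by
  set N := near G o with hN
  set S := far G o with hS
  have hm := two_mul_ncard_edgeSet G o
  have hρ : ρ ^ 2 = ∑ z ∈ N, degIn G N z * x z + ∑ v ∈ S, degIn G N v * x v := by
    have e1 := sum_degIn_comm (G := G) N N (fun _ => 1) x
    have e2 := sum_degIn_comm (G := G) N S (fun _ => 1) x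
    simp only [mul_one, one_mul] at e1 e2
    calc ρ ^ 2 = ρ * ∑ z ∈ N, x z := by rw [h.sum_near, sq]
      _ = ∑ z ∈ N, (∑ y ∈ N, adjMat G z y * x y + ∑ v ∈ S, adjMat G z v * x v) := by
          rw [Finset.mul_sum]
          exact Finset.sum_congr rfl fun z _ => h.mul_eq z
      _ = _ := by
          rw [Finset.sum_add_distrib, e1, e2]
          simp only [degIn, mul_comm]
  have h1 : ∑ z ∈ N, degIn G N z * (1 / 2 - x z) =
      1 / 2 * ∑ z ∈ N, degIn G N z - ∑ z ∈ N, degIn G N z * x z := by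
    rw [Finset.mul_sum, ← Finset.sum_sub_distrib]
    exact Finset.sum_congr rfl fun z _ => by ring
  have h2 : ∑ v ∈ S, degIn G N v * (1 - x v) =
      ∑ v ∈ S, degIn G N v - ∑ v ∈ S, degIn G N v * x v := by
    rw [← Finset.sum_sub_distrib]
    exact Finset.sum_congr rfl fun z _ => by ring
  rw [h1, h2]
  linarith

theorem mul_eq_farMass (h : IsPerronVector G ρ x o) (u : V) :
    ρ * x u = farMass G x o - farMiss G x o u + ∑ z ∈ near G o, adjMat G u z * x z := by
  rw [farMass_sub_farMiss, h.mul_eq, add_comm]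

theorem one_le_farMass_sub (h : IsPerronVector G ρ x o) {z : V} (hz : z ∈ near G o) :
    1 ≤ farMass G x o - farMiss G x o z := by
  rw [farMass_sub_farMiss, ← h.eq_one]
  refine le_trans (le_of_eq ?_) (Finset.single_le_sum (f := fun v => adjMat G z v * x v)
    (fun v _ => mul_nonneg (adjMat_nonneg z v) (h.pos v).le) (self_mem_far G o))
  simp [adjMat_of_adj (mem_near.1 hz).symm]

theorem mul_near_le (h : IsPerronVector G ρ x o)
    (hb : ∀ u v, G.Adj u v → ∑ w, adjMat G u w * adjMat G v w ≤ b) {z : V}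
    (hz : z ∈ near G o) (hbρ : b ≤ ρ) : (ρ - b) * x z ≤ farMass G x o := by
  obtain ⟨y, hy, hmax⟩ := Finset.exists_max_image (near G o) x ⟨z, hz⟩
  have h1 : ∑ w ∈ near G o, adjMat G y w * x w ≤ b * x y := by
    calc ∑ w ∈ near G o, adjMat G y w * x w ≤ degIn G (near G o) y * x y := by
          rw [degIn, Finset.sum_mul]
          exact Finset.sum_le_sum fun w hw =>
            mul_le_mul_of_nonneg_left (hmax w hw) (adjMat_nonneg y w)
      _ ≤ b * x y := mul_le_mul_of_nonneg_right (degIn_near_le hb hy) (h.pos y).le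
  have h2 := h.mul_eq_farMass y
  have h3 := farMiss_nonneg (G := G) h.pos o y
  have h4 := mul_le_mul_of_nonneg_left (hmax z hz) (sub_nonneg.2 hbρ)
  linarith

theorem farMass_sub_le (h : IsPerronVector G ρ x o)
    (hb : ∀ u v, G.Adj u v → ∑ w, adjMat G u w * adjMat G v w ≤ b) {y z : V}
    (hyz : G.Adj y z) : farMass G x o - b ≤ farMiss G x o y + farMiss G x o z := by
  have h1 : farMass G x o - (farMiss G x o y + farMiss G x o z) ≤
      ∑ v ∈ far G o, adjMat G y v * adjMat G z v := by
    rw [farMass, farMiss, farMiss, ← Finset.sum_add_distrib, ← Finset.sum_sub_distrib]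
    refine Finset.sum_le_sum fun v _ => ?_
    have := h.pos v
    have := h.le_one v
    by_cases h1 : G.Adj y v <;> by_cases h2 : G.Adj z v <;>
      simp [adjMat, h1, h2] <;> linarith
  have h2 : ∑ v ∈ far G o, adjMat G y v * adjMat G z v ≤ ∑ v, adjMat G y v * adjMat G z v :=
    Finset.sum_le_univ_sum_of_nonneg fun v => mul_nonneg (adjMat_nonneg y v) (adjMat_nonneg z v)
  linarith [hb y z hyz]

theorem near_le_of_farMass_le (h : IsPerronVector G ρ x o)
    (hb : ∀ u v, G.Adj u v → ∑ w, adjMat G u w * adjMat G v w ≤ b)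
    (hb1 : 1 ≤ b) (hbρ : 239 * b ≤ ρ) (hX : farMass G x o ≤ 11 * b) {z : V}
    (hz : z ∈ near G o) : x z ≤ 1 / 20 := by
  have h1 := h.mul_near_le hb hz (by linarith)
  have h2 : 238 * b * x z ≤ (ρ - b) * x z :=
    mul_le_mul_of_nonneg_right (by linarith) (h.pos z).le
  by_contra! hc
  nlinarith

theorem sum_far_mul_sum_near (o : V) (T : Finset V) :
    ∑ v ∈ T, x v * ∑ z ∈ near G o, (1 - adjMat G v z) * x z =
      ∑ z ∈ near G o, x z * ∑ v ∈ T, (1 - adjMat G z v) * x v := by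
  simp only [Finset.mul_sum]
  rw [Finset.sum_comm]
  refine Finset.sum_congr rfl fun z _ => Finset.sum_congr rfl fun v _ => ?_
  rw [adjMat_symm v z]
  ring

theorem mul_sum_near_le (h : IsPerronVector G ρ x o) (v : V) :
    1 / 3 * (x v * ∑ z ∈ near G o, (1 - adjMat G v z) * x z) ≤
      degIn G (near G o) v * (1 - x v) + 1 / 2 * degIn G (far G o) v := by
  set d := degIn G (near G o) v
  set f := degIn G (far G o) v
  set Y := ∑ w ∈ far G o, adjMat G v w * x w
  set K := ∑ z ∈ near G o, (1 - adjMat G v z) * x z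
  have hx0 := h.pos v
  have hx1 := h.le_one v
  have hK : ρ * (1 - x v) = K - Y := h.mul_one_sub v
  have hYf : Y ≤ f := Finset.sum_le_sum fun w _ =>
    mul_le_of_le_one_right (adjMat_nonneg v w) (h.le_one w)
  have hY0 : 0 ≤ Y := Finset.sum_nonneg fun w _ => mul_nonneg (adjMat_nonneg v w) (h.pos w).le
  have hd : ρ * x v ≤ d + Y := by
    rw [h.mul_eq v]
    exact add_le_add_left (Finset.sum_le_sum fun w _ =>
      mul_le_of_le_one_right (adjMat_nonneg v w) (h.le_one w)) _
  have hKρ : K ≤ ρ := by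
    rw [← h.sum_near]
    exact Finset.sum_le_sum fun w _ => by nlinarith [adjMat_nonneg (G := G) v w, h.pos w]
  have hd0 : 0 ≤ d := degIn_nonneg _ v
  rcases le_total (1 / 3 * (ρ * x v)) d with hc | hc
  · have h1 : 1 / 3 * (ρ * x v) * (1 - x v) ≤ d * (1 - x v) :=
      mul_le_mul_of_nonneg_right hc (by linarith)
    have h2 : 1 / 3 * (ρ * x v) * (1 - x v) = 1 / 3 * (x v * K) - 1 / 3 * (x v * Y) := by
      linear_combination (1 / 3 * x v) * hK
    have h3 : x v * Y ≤ Y := mul_le_of_le_one_left hY0 hx1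
    linarith
  · have h1 : x v * K ≤ x v * ρ := mul_le_mul_of_nonneg_left hKρ hx0.le
    have h2 : 0 ≤ d * (1 - x v) := mul_nonneg hd0 (by linarith)
    linarith

/-- If `ρ²` is larger than the number of edges minus one, the non-neighbors of `o` are
independent. -/
theorem far_independent (h : IsPerronVector G ρ x o)
    (hb : ∀ u v, G.Adj u v → ∑ w, adjMat G u w * adjMat G v w ≤ b)
    (hb1 : 1 ≤ b) (hbρ : 239 * b ≤ ρ) (hdef : G.edgeSet.ncard - ρ ^ 2 < 1) {p q : V}
    (hp : p ∈ far G o) (hq : q ∈ far G o) : ¬ G.Adj p q := by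
  classical
  intro hpq
  have hρ : 0 < ρ := by linarith
  have hD := h.deficit
  set N := near G o with hN
  set S := far G o with hS
  have hsubset : ({p, q} : Finset V) ⊆ S := by
    intro z hz
    simp only [Finset.mem_insert, Finset.mem_singleton] at hz
    rcases hz with rfl | rfl <;> assumption
  have hsplit : ∀ f : V → ℝ, ∑ v ∈ S, f v = ∑ v ∈ S \ {p, q}, f v + (f p + f q) := fun f => by
    rw [← Finset.sum_sdiff hsubset, Finset.sum_pair hpq.ne]
  have hp1 : 1 ≤ degIn G S p := one_le_degIn hpq hq
  have hq1 : 1 ≤ degIn G S q := one_le_degIn hpq.symm hp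
  have hloss : ∀ v, 0 ≤ degIn G N v * (1 - x v) := fun v =>
    mul_nonneg (degIn_nonneg _ v) (sub_nonneg.2 (h.le_one v))
  rcases le_or_gt (farMass G x o) (11 * b) with hX | hX
  · have h1 : 0 ≤ ∑ z ∈ N, degIn G N z * (1 / 2 - x z) :=
      sum_degIn_mul_half_sub_nonneg fun z hz y hy _ => by
        linarith [h.near_le_of_farMass_le hb hb1 hbρ hX hz,
          h.near_le_of_farMass_le hb hb1 hbρ hX hy]
    have h2 : 0 ≤ ∑ v ∈ S, degIn G N v * (1 - x v) := Finset.sum_nonneg fun v _ => hloss v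
    have h3 : 0 ≤ ∑ v ∈ S \ {p, q}, degIn G S v := Finset.sum_nonneg fun v _ => degIn_nonneg _ v
    rw [hsplit (degIn G S)] at hD
    linarith
  · set R : V → ℝ := fun z => ∑ v ∈ S \ {p, q}, (1 - adjMat G z v) * x v with hR
    have hR0 : ∀ z, 0 ≤ R z := fun z => Finset.sum_nonneg fun v _ =>
      mul_nonneg (sub_nonneg.2 (adjMat_le_one z v)) (h.pos v).le
    have hRmiss : ∀ z, farMiss G x o z - 2 ≤ R z := fun z => by
      have hle : ∀ v, (1 - adjMat G z v) * x v ≤ 1 := fun v => by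
        have := adjMat_nonneg (G := G) z v
        nlinarith [h.pos v, h.le_one v]
      rw [farMiss, hsplit]
      linarith [hle p, hle q]
    have h1 : 1 / 3 * ∑ z ∈ N, x z * R z ≤
        ∑ v ∈ S \ {p, q}, (degIn G N v * (1 - x v) + 1 / 2 * degIn G S v) := by
      rw [hR, ← sum_far_mul_sum_near, Finset.mul_sum]
      exact Finset.sum_le_sum fun v _ => h.mul_sum_near_le v
    set g : V → ℝ := fun z => if farMiss G x o z < 5 * b then x z else 0 with hg
    have h2 : 0 ≤ ∑ z ∈ N, degIn G N z * (1 / 2 - g z) := by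
      refine sum_degIn_mul_half_sub_nonneg fun z hz y hy hzy => ?_
      have := h.farMass_sub_le hb hzy
      have := h.le_one z
      have := h.le_one y
      simp only [hg]
      split_ifs <;> linarith
    have h3 : ∑ z ∈ N, degIn G N z * (1 / 2 - g z) ≤
        ∑ z ∈ N, degIn G N z * (1 / 2 - x z) + 1 / 3 * ∑ z ∈ N, x z * R z := by
      rw [Finset.mul_sum, ← Finset.sum_add_distrib]
      refine Finset.sum_le_sum fun z hz => ?_
      have hz0 := h.pos z
      simp only [hg]
      split_ifs with hc
      · linarith [mul_nonneg hz0.le (hR0 z)]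
      · have h4 : b ≤ 1 / 3 * R z := by linarith [hRmiss z]
        have h5 := mul_le_mul_of_nonneg_left ((degIn_near_le hb hz).trans h4) hz0.le
        linarith
    rw [Finset.sum_add_distrib, ← Finset.mul_sum] at h1
    rw [hsplit (degIn G S), hsplit fun v => degIn G N v * (1 - x v)] at hD
    linarith [hloss p, hloss q]

theorem sum_near_mul_farMiss_le (h : IsPerronVector G ρ x o)
    (hb : ∀ u v, G.Adj u v → ∑ w, adjMat G u w * adjMat G v w ≤ b) (hbρ : b ≤ ρ)
    (hind : ∀ v ∈ far G o, ∀ w ∈ far G o, ¬ G.Adj v w) :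
    (ρ - b) * ∑ z ∈ near G o, x z * farMiss G x o z ≤
      farMass G x o * ∑ v ∈ far G o, degIn G (near G o) v * (1 - x v) := by
  simp only [farMiss]
  rw [← sum_far_mul_sum_near, Finset.mul_sum, Finset.mul_sum]
  refine Finset.sum_le_sum fun v hv => ?_
  have h0 : ∑ w ∈ far G o, adjMat G v w * x w = 0 := Finset.sum_eq_zero fun w hw => by
    rw [adjMat_of_not_adj (hind v hv w hw), zero_mul]
  have h1 := h.mul_one_sub v
  have h2 := h.mul_eq v
  rw [h0, sub_zero] at h1
  rw [h0, add_zero] at h2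
  have h3 : (ρ - b) * (ρ * x v) ≤ farMass G x o * degIn G (near G o) v := by
    rw [h2, degIn, Finset.mul_sum, Finset.mul_sum]
    refine Finset.sum_le_sum fun z hz => ?_
    have := mul_le_mul_of_nonneg_left (h.mul_near_le hb hz hbρ) (adjMat_nonneg (G := G) v z)
    linarith
  rw [← h1]
  have h4 := mul_le_mul_of_nonneg_right h3 (sub_nonneg.2 (h.le_one v))
  linarith

theorem farMass_le (h : IsPerronVector G ρ x o)
    (hb : ∀ u v, G.Adj u v → ∑ w, adjMat G u w * adjMat G v w ≤ b)
    (hb1 : 1 ≤ b) (hbρ : 239 * b ≤ ρ) (hdef : G.edgeSet.ncard - ρ ^ 2 < 1)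
    (hind : ∀ v ∈ far G o, ∀ w ∈ far G o, ¬ G.Adj v w) {p q : V}
    (hp : p ∈ near G o) (hq : q ∈ near G o) (hpq : G.Adj p q) :
    farMass G x o ≤ 11 * b := by
  by_contra! hX
  set X := farMass G x o with hXdef
  have hρ : 0 < ρ := by linarith
  have hD := h.deficit
  have hX0 : 0 < X := by linarith
  have hS : 0 ≤ ∑ v ∈ far G o, degIn G (far G o) v :=
    Finset.sum_nonneg fun v _ => degIn_nonneg _ v
  have hL := h.sum_near_mul_farMiss_le hb (by linarith) hind
  set N := near G o with hN
  set g : V → ℝ := fun z => if farMiss G x o z < X / 10 then x z else 0 with hg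
  set H : V → ℝ := fun z => if farMiss G x o z < X / 10 then 0 else
    x z * ((ρ - b) * farMiss G x o z - b * X) with hH
  have hH0 : ∀ z, 0 ≤ H z := fun z => by
    simp only [hH]
    split_ifs with hc
    · exact le_rfl
    · refine mul_nonneg (h.pos z).le ?_
      nlinarith
  have hgood : ∀ z y, G.Adj z y →
      X / 10 ≤ farMiss G x o z ∨ X / 10 ≤ farMiss G x o y := fun z y hzy => by
    have := h.farMass_sub_le hb hzy
    by_contra! hc
    linarith
  have hgle : ∀ z ∈ N, ∀ y ∈ N, G.Adj z y → g z + g y ≤ 1 := fun z _ y _ hzy => by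
    have := h.le_one z
    have := h.le_one y
    simp only [hg]
    split_ifs with h1 h2
    · rcases hgood z y hzy with h3 | h3 <;> linarith
    all_goals linarith
  have h1 : X * ∑ z ∈ N, degIn G N z * (1 / 2 - g z) + ∑ z ∈ N, H z ≤
      X * ∑ z ∈ N, degIn G N z * (1 / 2 - x z) + (ρ - b) * ∑ z ∈ N, x z * farMiss G x o z := by
    rw [Finset.mul_sum, Finset.mul_sum, Finset.mul_sum, ← Finset.sum_add_distrib,
      ← Finset.sum_add_distrib]
    refine Finset.sum_le_sum fun z hz => ?_
    have hz0 := h.pos z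
    have hQ0 := farMiss_nonneg (G := G) h.pos o z
    simp only [hg, hH]
    split_ifs with hc
    · have : 0 ≤ (ρ - b) * (x z * farMiss G x o z) :=
        mul_nonneg (by linarith) (mul_nonneg hz0.le hQ0)
      linarith
    · have := mul_le_mul_of_nonneg_left (degIn_near_le hb hz) (mul_pos hX0 hz0).le
      linarith
  have h2 : X * ∑ z ∈ N, degIn G N z * (1 / 2 - g z) + ∑ z ∈ N, H z < X := by
    have : X * (∑ z ∈ N, degIn G N z * (1 / 2 - x z)
        + ∑ v ∈ far G o, degIn G N v * (1 - x v)) < X * 1 :=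
      mul_lt_mul_of_pos_left (by linarith) hX0
    linarith
  have hbig : ∀ y ∈ N, ∀ z ∈ N, G.Adj y z → X / 10 ≤ farMiss G x o y →
      farMiss G x o z < X / 10 → X * x z ≤ H y := by
    intro y hy z hz hyz hcy hcz
    have hP := h.one_le_farMass_sub hy
    have hxz : 238 * x z ≤ X := by
      refine le_trans ?_ (h.mul_near_le hb hz (by linarith))
      exact mul_le_mul_of_nonneg_right (by linarith) (h.pos z).le
    have haux := mul_le_sub_add_mul_sub hcy hP (h.pos z) (h.le_one z) hxz
    have hy1 : X - farMiss G x o y + x z ≤ ρ * x y := by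
      rw [h.mul_eq_farMass y]
      refine add_le_add_right (le_trans (le_of_eq ?_) (Finset.single_le_sum
        (f := fun w => adjMat G y w * x w)
        (fun v _ => mul_nonneg (adjMat_nonneg y v) (h.pos v).le) hz)) _
      simp [adjMat_of_adj hyz]
    simp only [hH, if_neg (not_lt.2 hcy)]
    have h3 : ρ * (238 * farMiss G x o y - X) ≤ 239 * ((ρ - b) * farMiss G x o y - b * X) := by
      have : 0 ≤ (ρ - 239 * b) * (farMiss G x o y + X) :=
        mul_nonneg (by linarith) (by linarith)
      linarith
    have h4 : ρ * (x y * (238 * farMiss G x o y - X)) ≤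
        239 * (x y * ((ρ - b) * farMiss G x o y - b * X)) := by
      have := mul_le_mul_of_nonneg_left h3 (h.pos y).le
      linarith
    have h5 := mul_le_mul_of_nonneg_right hy1
      (show 0 ≤ 238 * farMiss G x o y - X by linarith)
    linarith
  have h3 := mul_le_mul_of_nonneg_left (le_sum_degIn_mul_half_sub hgle hp hq hpq) hX0.le
  have hHsum : ∀ z ∈ N, H z ≤ ∑ z ∈ N, H z := fun z hz =>
    Finset.single_le_sum (fun v _ => hH0 v) hz
  rcases lt_or_ge (farMiss G x o p) (X / 10) with hcp | hcp <;>
    rcases lt_or_ge (farMiss G x o q) (X / 10) with hcq | hcq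
  · rcases hgood p q hpq with h4 | h4 <;> linarith
  · have h4 := hbig q hq p hp hpq.symm hcq hcp
    simp only [hg, if_pos hcp, if_neg (not_lt.2 hcq)] at h3 h2
    linarith [hHsum q hq]
  · have h4 := hbig p hp q hq hpq hcp hcq
    simp only [hg, if_pos hcq, if_neg (not_lt.2 hcp)] at h3 h2
    linarith [hHsum p hp]
  · simp only [hg, if_neg (not_lt.2 hcp), if_neg (not_lt.2 hcq)] at h3 h2
    linarith [hHsum p hp, hH0 p]

theorem eq_of_near_adj (h : IsPerronVector G ρ x o)
    (hdef : G.edgeSet.ncard - ρ ^ 2 < 1) (hsmall : ∀ z ∈ near G o, x z ≤ 1 / 20) {p q y z : V}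
    (hp : p ∈ near G o) (hq : q ∈ near G o) (hpq : G.Adj p q)
    (hy : y ∈ near G o) (hz : z ∈ near G o) (hyz : G.Adj y z) :
    (y = p ∧ z = q) ∨ (y = q ∧ z = p) := by
  classical
  by_contra! hne
  have hD := h.deficit
  set N := near G o
  have h1 : 0 ≤ ∑ v ∈ far G o, degIn G N v * (1 - x v) := Finset.sum_nonneg fun v _ =>
    mul_nonneg (degIn_nonneg _ v) (sub_nonneg.2 (h.le_one v))
  have h2 : 0 ≤ ∑ v ∈ far G o, degIn G (far G o) v :=
    Finset.sum_nonneg fun v _ => degIn_nonneg _ v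
  have h3 : 9 / 20 * ∑ z ∈ N, degIn G N z ≤ ∑ z ∈ N, degIn G N z * (1 / 2 - x z) := by
    rw [Finset.mul_sum]
    exact Finset.sum_le_sum fun z hz => by
      nlinarith [degIn_nonneg (G := G) N z, hsmall z hz]
  have hsub : ({(p, q), (q, p), (y, z)} : Finset (V × V)) ⊆ N ×ˢ N := by
    intro w hw
    simp only [Finset.mem_insert, Finset.mem_singleton] at hw
    rcases hw with rfl | rfl | rfl <;> simp [hp, hq, hy, hz]
  have h4 := Finset.sum_le_sum_of_subset_of_nonneg
    (f := fun w : V × V => adjMat G w.1 w.2) hsub fun w _ _ => adjMat_nonneg _ _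
  rw [Finset.sum_insert, Finset.sum_pair, Finset.sum_product] at h4
  · simp only [adjMat_of_adj hpq, adjMat_of_adj hpq.symm, adjMat_of_adj hyz] at h4
    change _ ≤ ∑ z ∈ N, degIn G N z at h4
    linarith
  · intro he
    rw [Prod.mk.injEq] at he
    exact hne.2 he.1.symm he.2.symm
  · simp only [Finset.mem_insert, Finset.mem_singleton, Prod.mk.injEq, not_or, not_and]
    exact ⟨fun he => absurd he hpq.ne, fun he he' => hne.1 he.symm he'.symm⟩

theorem near_adj_far (h : IsPerronVector G ρ x o)
    (hb : ∀ u v, G.Adj u v → ∑ w, adjMat G u w * adjMat G v w ≤ b)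
    (hb1 : 1 ≤ b) (hbρ : 239 * b ≤ ρ) (hdef : G.edgeSet.ncard - ρ ^ 2 < 1)
    (hind : ∀ v ∈ far G o, ∀ w ∈ far G o, ¬ G.Adj v w)
    (hsmall : ∀ z ∈ near G o, x z ≤ 1 / 20) {p q z v : V}
    (hp : p ∈ near G o) (hq : q ∈ near G o) (hpq : G.Adj p q)
    (hz : z ∈ near G o) (hv : v ∈ far G o) : G.Adj z v := by
  by_contra hzv
  have hρ : 0 < ρ := by linarith
  have hD := h.deficit
  have hL := h.sum_near_mul_farMiss_le hb (by linarith) hind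
  have hP := h.one_le_farMass_sub hz
  have hS : 0 ≤ ∑ v ∈ far G o, degIn G (far G o) v :=
    Finset.sum_nonneg fun v _ => degIn_nonneg _ v
  have h1 := le_sum_degIn_mul_half_sub (G := G) (g := x)
    (fun z hz y hy _ => by linarith [hsmall z hz, hsmall y hy]) hp hq hpq
  have hloss : ∑ v ∈ far G o, degIn G (near G o) v * (1 - x v) ≤ 1 / 10 := by
    linarith [hsmall p hp, hsmall q hq]
  have hdeg : 1 ≤ degIn G (near G o) v := by
    have h2 : 0 < ∑ w ∈ near G o, adjMat G v w * x w := by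
      have h3 := h.mul_eq v
      rw [Finset.sum_eq_zero (s := far G o) fun w hw => by
        rw [adjMat_of_not_adj (hind v hv w hw), zero_mul], add_zero] at h3
      rw [← h3]
      exact mul_pos hρ (h.pos v)
    obtain ⟨w, hw, hw0⟩ := Finset.exists_ne_zero_of_sum_ne_zero h2.ne'
    refine one_le_degIn (v := w) ?_ hw
    by_contra hvw
    simp [adjMat_of_not_adj hvw] at hw0
  have hxv : 9 / 10 ≤ x v := by
    have h2 : degIn G (near G o) v * (1 - x v) ≤ 1 / 10 :=
      (Finset.single_le_sum (f := fun v => degIn G (near G o) v * (1 - x v)) (fun v _ =>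
        mul_nonneg (degIn_nonneg _ v) (sub_nonneg.2 (h.le_one v))) hv).trans hloss
    nlinarith [h.le_one v]
  have hQ : 9 / 10 ≤ farMiss G x o z := by
    refine hxv.trans (le_trans (le_of_eq ?_) (Finset.single_le_sum
      (f := fun v => (1 - adjMat G z v) * x v)
      (fun w _ => mul_nonneg (sub_nonneg.2 (adjMat_le_one z w)) (h.pos w).le) hv))
    simp [adjMat_of_not_adj hzv]
  have hρz : farMass G x o - farMiss G x o z ≤ ρ * x z := by
    rw [h.mul_eq_farMass z]
    linarith [Finset.sum_nonneg fun w (_ : w ∈ near G o) =>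
      mul_nonneg (adjMat_nonneg (G := G) z w) (h.pos w).le]
  set X := farMass G x o
  set Q := farMiss G x o z
  have h3 : (ρ - b) * (x z * Q) ≤ X * (1 / 10) := by
    refine le_trans (mul_le_mul_of_nonneg_left ?_ (by linarith))
      (hL.trans (mul_le_mul_of_nonneg_left hloss (by linarith)))
    exact Finset.single_le_sum (f := fun z => x z * farMiss G x o z)
      (fun w _ => mul_nonneg (h.pos w).le (farMiss_nonneg h.pos o w)) hz
  have h4 : 1 / 2 * (ρ * (x z * Q)) ≤ (ρ - b) * (x z * Q) := by
    have : 0 ≤ x z * Q := mul_nonneg (h.pos z).le (by linarith)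
    nlinarith
  have h5 : (X - Q) * Q ≤ ρ * x z * Q := mul_le_mul_of_nonneg_right hρz (by linarith)
  nlinarith

end IsPerronVector

end LocalStructure

section Extremal

variable {V : Type*} {G : SimpleGraph V}

theorem exists_equiv_fin_apply_eq {α : Type*} [Fintype α] {p q : α} (hpq : p ≠ q) :
    ∃ e : α ≃ Fin (Fintype.card α), (e p : ℕ) = 0 ∧ (e q : ℕ) = 1 := by
  have hcard : 1 < Fintype.card α := Fintype.one_lt_card_iff.2 ⟨p, q, hpq⟩
  let i : Fin (Fintype.card α) := ⟨0, by omega⟩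
  let j : Fin (Fintype.card α) := ⟨1, hcard⟩
  have hij : i ≠ j := by simp [i, j]
  let e₀ := (Fintype.equivFin α).trans (Equiv.swap (Fintype.equivFin α p) i)
  have hp : e₀ p = i := by simp [e₀]
  have hq : e₀ q ≠ i := fun h => hpq (e₀.injective (hp.trans h.symm))
  refine ⟨e₀.trans (Equiv.swap (e₀ q) j), ?_, ?_⟩
  · rw [Equiv.trans_apply, hp, Equiv.swap_apply_of_ne_of_ne hq.symm hij]
  · rw [Equiv.trans_apply, Equiv.swap_apply_left]

variable [Fintype V]

theorem nonempty_iso_SPlus {o p q : V}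
    (hind : ∀ v ∈ far G o, ∀ w ∈ far G o, ¬ G.Adj v w)
    (hjoin : ∀ z ∈ near G o, ∀ v ∈ far G o, G.Adj z v)
    (hp : p ∈ near G o) (hq : q ∈ near G o) (hpq : G.Adj p q)
    (huniq : ∀ y ∈ near G o, ∀ z ∈ near G o, G.Adj y z → (y = p ∧ z = q) ∨ (y = q ∧ z = p)) :
    Nonempty (G ≃g SPlus (far G o).card (near G o).card) := by
  classical
  obtain ⟨e, hep, heq⟩ := exists_equiv_fin_apply_eq
    (p := (⟨p, mem_near.1 hp⟩ : {v // G.Adj o v})) (q := ⟨q, mem_near.1 hq⟩)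
    (fun h => hpq.ne (congrArg Subtype.val h))
  have hcN : Fintype.card {v // G.Adj o v} = (near G o).card := by
    rw [Fintype.card_subtype, near]
  have hcS : Fintype.card {v // ¬ G.Adj o v} = (far G o).card := by
    rw [Fintype.card_subtype, far]
  rw [← hcN, ← hcS]
  let φ : V ≃ Fin (Fintype.card {v // ¬ G.Adj o v}) ⊕ Fin (Fintype.card {v // G.Adj o v}) :=
    (Equiv.sumCompl (G.Adj o)).symm.trans
      ((Equiv.sumComm _ _).trans (Equiv.sumCongr (Fintype.equivFin _) e))
  have hφn : ∀ v (hv : G.Adj o v), φ v = Sum.inr (e ⟨v, hv⟩) := fun v hv => by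
    simp [φ, Equiv.sumCompl_symm_apply_of_pos hv]
  have hφf : ∀ v (hv : ¬ G.Adj o v), φ v = Sum.inl (Fintype.equivFin _ ⟨v, hv⟩) := fun v hv => by
    simp [φ, Equiv.sumCompl_symm_apply_of_neg hv]
  have hzero : ∀ y (hy : G.Adj o y), (e ⟨y, hy⟩ : ℕ) = 0 ↔ y = p := fun y hy => by
    rw [← hep, ← Fin.ext_iff, e.apply_eq_iff_eq, Subtype.mk.injEq]
  have hone : ∀ y (hy : G.Adj o y), (e ⟨y, hy⟩ : ℕ) = 1 ↔ y = q := fun y hy => by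
    rw [← heq, ← Fin.ext_iff, e.apply_eq_iff_eq, Subtype.mk.injEq]
  refine ⟨⟨φ, fun {y z} => ?_⟩⟩
  rw [SPlus, SimpleGraph.fromRel_adj, φ.injective.ne_iff]
  by_cases hy : G.Adj o y <;> by_cases hz : G.Adj o z
  · have h1 : G.Adj y z ↔ (y = p ∧ z = q) ∨ (y = q ∧ z = p) := by
      refine ⟨huniq y (mem_near.2 hy) z (mem_near.2 hz), ?_⟩
      rintro (⟨rfl, rfl⟩ | ⟨rfl, rfl⟩)
      exacts [hpq, hpq.symm]
    simp only [hφn y hy, hφn z hz, h1, Sum.isLeft_inr, Sum.inr.injEq, ne_eq]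
    have key : ∀ a b (ha : G.Adj o a) (hb : G.Adj o b),
        (∃ i j, e ⟨a, ha⟩ = i ∧ e ⟨b, hb⟩ = j ∧ (i : ℕ) = 0 ∧ (j : ℕ) = 1) ↔ a = p ∧ b = q := by
      intro a b ha hb
      rw [← hzero a ha, ← hone b hb]
      simp
    simp only [key, Bool.false_eq_true, false_and, false_or]
    constructor
    · rintro ⟨-, h | h⟩
      exacts [Or.inl h, Or.inr h.symm]
    · rintro (⟨rfl, rfl⟩ | ⟨rfl, rfl⟩)
      exacts [⟨hpq.ne, Or.inl ⟨rfl, rfl⟩⟩, ⟨hpq.ne', Or.inr ⟨rfl, rfl⟩⟩]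
  · have h1 := hjoin y (mem_near.2 hy) z (mem_far.2 hz)
    simp [hφn y hy, hφf z hz, h1, h1.ne]
  · have h1 := (hjoin z (mem_near.2 hz) y (mem_far.2 hy)).symm
    simp [hφf y hy, hφn z hz, h1, h1.ne]
  · have h1 := hind y (mem_far.2 hy) z (mem_far.2 hz)
    simp [hφf y hy, hφf z hz, h1]

theorem ncard_edgeSet_eq {o p q : V}
    (hind : ∀ v ∈ far G o, ∀ w ∈ far G o, ¬ G.Adj v w)
    (hjoin : ∀ z ∈ near G o, ∀ v ∈ far G o, G.Adj z v)
    (hp : p ∈ near G o) (hq : q ∈ near G o) (hpq : G.Adj p q)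
    (huniq : ∀ y ∈ near G o, ∀ z ∈ near G o, G.Adj y z → (y = p ∧ z = q) ∨ (y = q ∧ z = p)) :
    G.edgeSet.ncard = (far G o).card * (near G o).card + 1 := by
  classical
  have h := two_mul_ncard_edgeSet G o
  have h1 : ∑ v ∈ far G o, degIn G (far G o) v = 0 :=
    Finset.sum_eq_zero fun v hv => Finset.sum_eq_zero fun w hw =>
      adjMat_of_not_adj (hind v hv w hw)
  have h2 : ∑ v ∈ far G o, degIn G (near G o) v = (far G o).card * (near G o).card := by
    have : ∀ v ∈ far G o, degIn G (near G o) v = (near G o).card := fun v hv => by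
      rw [degIn, Finset.sum_congr rfl fun z hz => adjMat_of_adj (hjoin z hz v hv).symm]
      simp
    rw [Finset.sum_congr rfl this]
    simp
  have h3 : ∑ z ∈ near G o, degIn G (near G o) z = 2 := by
    have hsub : ({(p, q), (q, p)} : Finset (V × V)) ⊆ near G o ×ˢ near G o := by
      intro w hw
      simp only [Finset.mem_insert, Finset.mem_singleton] at hw
      rcases hw with rfl | rfl <;> simp [hp, hq]
    have hsum := Finset.sum_subset (f := fun w : V × V => adjMat G w.1 w.2) hsub (by
      rintro ⟨y, z⟩ hyz hne
      rw [Finset.mem_product] at hyz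
      refine adjMat_of_not_adj fun hadj => hne ?_
      rcases huniq y hyz.1 z hyz.2 hadj with ⟨rfl, rfl⟩ | ⟨rfl, rfl⟩ <;> simp)
    rw [Finset.sum_product, Finset.sum_pair (by simp [hpq.ne])] at hsum
    simp only [adjMat_of_adj hpq, adjMat_of_adj hpq.symm] at hsum
    exact hsum.symm.trans one_add_one_eq_two
  rw [h1, h2, h3] at h
  have : (G.edgeSet.ncard : ℝ) = ((far G o).card * (near G o).card + 1 : ℕ) := by
    push_cast
    linarith
  exact_mod_cast this

theorem colorable_two_of_far_independent {o : V}
    (hind : ∀ v ∈ far G o, ∀ w ∈ far G o, ¬ G.Adj v w)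
    (hN : ∀ y ∈ near G o, ∀ z ∈ near G o, ¬ G.Adj y z) : G.Colorable 2 := by
  classical
  refine ⟨SimpleGraph.Coloring.mk (fun v => if G.Adj o v then (0 : Fin 2) else 1) ?_⟩
  intro y z hyz
  by_cases hy : G.Adj o y <;> by_cases hz : G.Adj o z
  · exact absurd hyz (hN y (mem_near.2 hy) z (mem_near.2 hz))
  · simp [hy, hz]
  · simp [hy, hz]
  · exact absurd hyz (hind y (mem_far.2 hy) z (mem_far.2 hz))

end Extremal

/-- Let `G` be a connected non-bipartite graph with `m ≥ 240²` edges
whose spectral radius `ρ` satisfies `ρ² ≥ m - 1 + 2/(ρ - 1)`.  Then the booksize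
satisfies `bk(G) > (1/240)√m` (i.e. some two adjacent vertices have more than
`(1/240)√m` common neighbors), unless `G ≅ S⁺_{m,s}` for some positive integer
`s ≤ (1/240)√m` with `s ∣ m - 1`. -/
theorem nonbipartite_booksize {V : Type*} [Fintype V] [DecidableEq V]
    (G : SimpleGraph V) (hconn : G.Connected) (hnb : ¬ G.Colorable 2)
    (m : ℕ) (hm : G.edgeSet.ncard = m) (hm' : 240 ^ 2 ≤ m)
    (hρ : (m : ℝ) - 1 + 2 / (specRad G - 1) ≤ specRad G ^ 2) :
    (∃ u v, G.Adj u v ∧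
        (1 / 240 : ℝ) * Real.sqrt m < ((G.neighborSet u ∩ G.neighborSet v).ncard : ℝ)) ∨
      ∃ s : ℕ, 1 ≤ s ∧ (s : ℝ) ≤ (1 / 240 : ℝ) * Real.sqrt m ∧ s ∣ (m - 1) ∧
        Nonempty (G ≃g SPlus s ((m - 1) / s)) := by
  by_contra! hcon
  obtain ⟨hbook, hne⟩ := hcon
  obtain ⟨x, o, h⟩ := exists_isPerronVector hconn
  set ρ := specRad G
  set b : ℝ := 1 / 240 * Real.sqrt m with hbdef
  have hmR : (240 : ℝ) ^ 2 ≤ m := by exact_mod_cast hm'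
  have hsq : Real.sqrt m ^ 2 = m := Real.sq_sqrt (by positivity)
  have hb1 : 1 ≤ b := by
    have : (240 : ℝ) ≤ Real.sqrt m := Real.le_sqrt_of_sq_le hmR
    linarith
  have hρ1 : 1 < ρ := h.one_lt hconn (by omega)
  have hpos : 0 < 2 / (ρ - 1) := div_pos two_pos (by linarith)
  have hdef : (G.edgeSet.ncard : ℝ) - ρ ^ 2 < 1 := by
    rw [hm]
    linarith
  have hbρ : 239 * b ≤ ρ := by
    refine le_of_sq_le_sq ?_ (by linarith)
    have : (239 * b) ^ 2 = (239 / 240) ^ 2 * m := by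
      rw [← hsq, hbdef]
      ring
    rw [this]
    linarith
  have hb : ∀ u v, G.Adj u v → ∑ w, adjMat G u w * adjMat G v w ≤ b := fun u v huv => by
    rw [sum_adjMat_mul_adjMat]
    exact hbook u v huv
  have hind : ∀ v ∈ far G o, ∀ w ∈ far G o, ¬ G.Adj v w := fun v hv w hw =>
    h.far_independent hb hb1 hbρ hdef hv hw
  obtain ⟨p, hp, q, hq, hpq⟩ : ∃ p ∈ near G o, ∃ q ∈ near G o, G.Adj p q := by
    by_contra! hN
    exact hnb (colorable_two_of_far_independent hind hN)
  have hX := h.farMass_le hb hb1 hbρ hdef hind hp hq hpq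
  have hsmall : ∀ z ∈ near G o, x z ≤ 1 / 20 := fun z hz =>
    h.near_le_of_farMass_le hb hb1 hbρ hX hz
  have huniq : ∀ y ∈ near G o, ∀ z ∈ near G o, G.Adj y z →
      (y = p ∧ z = q) ∨ (y = q ∧ z = p) := fun y hy z hz hyz =>
    h.eq_of_near_adj hdef hsmall hp hq hpq hy hz hyz
  have hjoin : ∀ z ∈ near G o, ∀ v ∈ far G o, G.Adj z v := fun z hz v hv =>
    h.near_adj_far hb hb1 hbρ hdef hind hsmall hp hq hpq hz hv
  have hcard := ncard_edgeSet_eq hind hjoin hp hq hpq huniq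
  have hs : 0 < (far G o).card := Finset.card_pos.2 ⟨o, self_mem_far G o⟩
  have hst : m - 1 = (far G o).card * (near G o).card := by omega
  have hsb : ((far G o).card : ℝ) ≤ b := by
    refine le_trans ?_ (hbook p q hpq)
    have hsub : (far G o : Set V) ⊆ G.neighborSet p ∩ G.neighborSet q :=
      fun v hv => ⟨hjoin p hp v hv, hjoin q hq v hv⟩
    rw [← Set.ncard_coe_finset]
    exact_mod_cast Set.ncard_le_ncard hsub (Set.toFinite _)
  have hiso := nonempty_iso_SPlus hind hjoin hp hq hpq huniq
  rw [← Nat.mul_div_cancel_left (near G o).card hs, ← hst] at hiso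
  exact not_nonempty_iff.2 (hne _ hs hsb ⟨_, hst⟩) hiso
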